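/- Let A : (A₁ →d A₀) be a 2-term complex of finite ℂ[∂]-modules. Set CEnd⁰(A) = {(f₀,f₁) : f₀ ∈ CEnd(A₀), f₁ ∈ CEnd(A₁), d ∘ f₁ = f₀ ∘ d} and CEnd¹(A) = CHom(A₀,A₁), and define Δ : CEnd¹(A) → CEnd⁰(A) by Δ(h) = (d ∘ h, h ∘ d). Then CEnd(A) := CEnd⁰(A) ⊕ CEnd¹(A) (with CEnd⁰ in degree 0 and CEnd¹ in degree 1) is a differential graded Lie conformal algebra with differential Δ and λ-bracket [(f₀,f₁)_λ (g₀,g₁)] := ((f₀)_λ g₀ − (g₀)_{−∂−λ} f₀, (f₁)_λ g₁ − (g₁)_{−∂−λ} f₁) and [(f₀,f₁)_λ h] = −[h_{−∂−λ} (f₀,f₁)] := (f₁)_λ h − h_{−∂−λ} f₀: that is, the bracket is conformal sesquilinear, graded skew-symmetric ([a_λ b] = −(−1)^{|a||b|}[b_{−∂−λ} a]), satisfies the graded Jacobi identity [a_λ[b_μ c]] = [[a_λ b]_{λ+μ} c] + (−1)^{|a||b|}[b_μ[a_λ c]], Δ² = 0 and Δ[a_λ b] = [Δa_λ b] + (−1)^{|a|}[a_λ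 Δb]. -/

import Mathlib

noncomputable section
open scoped BigOperators

namespace CE

/-- The `λ+μ` substitution sum: coefficient of `λ^m μ^n` in `F(λ, λ+μ)`. -/
def substSum {M : Type*} [AddCommMonoid M] (F : ℕ → ℕ → M) (m n : ℕ) : M :=
  ∑ j ∈ Finset.range (m + 1), ((m - j + n).choose n) • F j (m - j + n)

variable {A B : Type*}

/-- A conformal linear map `f : A → B[λ]` is encoded by its coefficients
`f x n` (of `λ^n`).  `IsCH DA DB f` says: `f` is ℂ-linear, satisfies
`f_λ(∂x) = (∂+λ) f_λ(x)`, and is polynomial in `λ` (which holds automatically for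
finite `ℂ[∂]`-modules). -/
def IsCH [AddCommGroup A] [Module ℂ A] [AddCommGroup B] [Module ℂ B]
    (DA : A →ₗ[ℂ] A) (DB : B →ₗ[ℂ] B) (f : A → ℕ → B) : Prop :=
  (∀ x y n, f (x + y) n = f x n + f y n) ∧
  (∀ (c : ℂ) x n, f (c • x) n = c • f x n) ∧
  (∀ x n, f (DA x) n = DB (f x n) + (if n = 0 then 0 else f x (n - 1))) ∧
  (∀ x, ∃ N, ∀ n, N ≤ n → f x n = 0)

/-- The action of `∂` on conformal linear maps: `(∂f)_λ = −λ f_λ`. -/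
def Dch [AddCommGroup B] (f : A → ℕ → B) : A → ℕ → B :=
  fun x n => match n with
  | 0 => 0
  | n + 1 => - f x n

/-- The coefficient of `λ^a μ^b` in `[f_λ g]_μ(x) = f_λ(g_{μ−λ}(x)) − g_{μ−λ}(f_λ(x))`,
i.e. the `λ`-bracket `[f_λ g] = f_λ g − g_{−∂−λ} f` of conformal endomorphisms,
realized on elements. -/
def cbr [AddCommGroup A] (f g : A → ℕ → A) : ℕ → A → ℕ → A :=
  fun a x b => ∑ p ∈ Finset.range (a + 1),
    (((-1 : ℤ) ^ p) * ((p + b).choose b)) •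
      (f (g x (p + b)) (a - p) - g (f x (a - p)) (p + b))

variable {A0 A1 : Type*}

/-- `[(f₀,f₁)_λ h] = (f₁)_λ h − h_{−∂−λ} f₀` for `(f₀,f₁) ∈ CEnd⁰(A)` and
`h ∈ CEnd¹(A) = CHom(A₀,A₁)`, realized on elements (coefficient of `λ^a μ^b`). -/
def cbr01 [AddCommGroup A0] [AddCommGroup A1]
    (f0 : A0 → ℕ → A0) (f1 : A1 → ℕ → A1) (h : A0 → ℕ → A1) : ℕ → A0 → ℕ → A1 :=
  fun a x b => ∑ p ∈ Finset.range (a + 1),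
    (((-1 : ℤ) ^ p) * ((p + b).choose b)) •
      (f1 (h x (p + b)) (a - p) - h (f0 x (a - p)) (p + b))

/-- `[h_λ (f₀,f₁)] = h_λ f₀ − (f₁)_{−∂−λ} h`, realized on elements. -/
def cbr10 [AddCommGroup A0] [AddCommGroup A1]
    (h : A0 → ℕ → A1) (f0 : A0 → ℕ → A0) (f1 : A1 → ℕ → A1) : ℕ → A0 → ℕ → A1 :=
  fun a x b => ∑ p ∈ Finset.range (a + 1),
    (((-1 : ℤ) ^ p) * ((p + b).choose b)) •
      (h (f0 x (p + b)) (a - p) - f1 (h x (a - p)) (p + b))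

/-- `CEnd⁰(A)` membership for a pair `(f₀, f₁)`: both components are conformal linear
maps and `d ∘ f₁ = f₀ ∘ d`. -/
def IsC0 [AddCommGroup A0] [Module ℂ A0] [AddCommGroup A1] [Module ℂ A1]
    (D0 : A0 →ₗ[ℂ] A0) (D1 : A1 →ₗ[ℂ] A1) (dd : A1 →ₗ[ℂ] A0)
    (F : (A0 → ℕ → A0) × (A1 → ℕ → A1)) : Prop :=
  IsCH D0 D0 F.1 ∧ IsCH D1 D1 F.2 ∧ ∀ v n, dd (F.2 v n) = F.1 (dd v) n

/-- `CEnd¹(A) = CHom(A₀, A₁)` membership. -/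
def IsC1 [AddCommGroup A0] [Module ℂ A0] [AddCommGroup A1] [Module ℂ A1]
    (D0 : A0 →ₗ[ℂ] A0) (D1 : A1 →ₗ[ℂ] A1) (h : A0 → ℕ → A1) : Prop :=
  IsCH D0 D1 h

/-- Finite generation of a `ℂ[∂]`-module. -/
def FinPart [AddCommGroup A] [Module ℂ A] (D : A →ₗ[ℂ] A) : Prop :=
  ∃ (n : ℕ) (g : Fin n → A), ∀ v : A,
    v ∈ Submodule.span ℂ (Set.range fun p : Fin n × ℕ => (D ^ p.2) (g p.1))

end CE

namespace CE
/-- The differential `Δ` on `CEnd(A) = CEnd⁰(A) ⊕ CEnd¹(A)`: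
`Δ(h) = (d∘h, h∘d)` on `CEnd¹` and `Δ = 0` on `CEnd⁰`. -/
def DGdiff {A0 A1 : Type*} [AddCommGroup A0] [Module ℂ A0] [AddCommGroup A1] [Module ℂ A1]
    (dd : A1 →ₗ[ℂ] A0)
    (u : ((A0 → ℕ → A0) × (A1 → ℕ → A1)) × (A0 → ℕ → A1)) :
    ((A0 → ℕ → A0) × (A1 → ℕ → A1)) × (A0 → ℕ → A1) :=
  (((fun x n => dd (u.2 x n)), (fun v n => u.2 (dd v) n)), fun _ _ => 0)

theorem sum_range_antidiagonal {V : Type*} [AddCommMonoid V] {G : ℕ → ℕ → V} {N M : ℕ}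
    (hG : ∀ p q, N ≤ p ∨ N ≤ q → G p q = 0)
    (hM : ∀ p q, M ≤ p + q → G p q = 0) :
    ∑ a ∈ Finset.range M, ∑ x ∈ Finset.HasAntidiagonal.antidiagonal a, G x.1 x.2
      = ∑ p ∈ Finset.range N, ∑ q ∈ Finset.range N, G p q := by
  rw [← Finset.sum_product', Finset.sum_sigma']
  refine Finset.sum_bij_ne_zero (fun x _ _ => x.2) ?_ ?_ ?_ ?_
  · rintro ⟨a, p, q⟩ _ h
    simp only [Finset.mem_product, Finset.mem_range]
    by_contra hc
    exact h (hG p q (by omega))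
  · rintro ⟨a, p, q⟩ ha _ ⟨b, p', q'⟩ hb _ h
    simp only [Finset.mem_sigma, Finset.HasAntidiagonal.mem_antidiagonal] at ha hb
    obtain ⟨rfl, rfl⟩ := Prod.mk.inj h
    rw [← ha.2, ← hb.2]
  · rintro ⟨p, q⟩ _ h
    refine ⟨⟨p + q, p, q⟩, ?_, h, rfl⟩
    simp only [Finset.mem_sigma, Finset.mem_range, Finset.HasAntidiagonal.mem_antidiagonal, and_true]
    by_contra hc
    exact h (hM p q (by omega))
  · intros
    rfl

section Eval

variable {V W : Type*} [AddCommGroup V] [Module ℂ V] [AddCommGroup W] [Module ℂ W]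

/-- Evaluation at `t` of the polynomial with coefficients `u n`. -/
def ev (t : ℂ) (u : ℕ → V) : V := ∑ᶠ n, t ^ n • u n

theorem ev_eq_sum {u : ℕ → V} {N : ℕ} (hu : ∀ n, N ≤ n → u n = 0) (t : ℂ) :
    ev t u = ∑ n ∈ Finset.range N, t ^ n • u n := by
  refine finsum_eq_sum_of_support_subset _ fun n hn => ?_
  by_contra h
  refine hn ?_
  simp only [Finset.coe_range, Set.mem_Iio, not_lt] at h
  simp [hu n h]

theorem map_ev (φ : V →ₗ[ℂ] W) {u : ℕ → V} {N : ℕ} (hu : ∀ n, N ≤ n → u n = 0) (t : ℂ) :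
    φ (ev t u) = ev t fun n => φ (u n) := by
  rw [ev_eq_sum hu, ev_eq_sum (N := N) (fun n hn => by rw [hu n hn, map_zero])]
  simp

theorem ev_zero (t : ℂ) : ev t (fun _ => (0 : V)) = 0 := by simp [ev]

theorem ev_add {u v : ℕ → V} {N : ℕ} (hu : ∀ n, N ≤ n → u n = 0) (hv : ∀ n, N ≤ n → v n = 0)
    (t : ℂ) : ev t (fun n => u n + v n) = ev t u + ev t v := by
  rw [ev_eq_sum hu, ev_eq_sum hv,
    ev_eq_sum (N := N) (fun n hn => by rw [hu n hn, hv n hn, add_zero])]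
  simp [Finset.sum_add_distrib]

theorem ev_sub {u v : ℕ → V} {N : ℕ} (hu : ∀ n, N ≤ n → u n = 0) (hv : ∀ n, N ≤ n → v n = 0)
    (t : ℂ) : ev t (fun n => u n - v n) = ev t u - ev t v := by
  rw [ev_eq_sum hu, ev_eq_sum hv,
    ev_eq_sum (N := N) (fun n hn => by rw [hu n hn, hv n hn, sub_zero])]
  simp [Finset.sum_sub_distrib, smul_sub]

theorem ev_sum {ι : Type*} (s : Finset ι) {u : ι → ℕ → V} {N : ℕ}
    (hu : ∀ i ∈ s, ∀ n, N ≤ n → u i n = 0) (t : ℂ) :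
    ev t (fun n => ∑ i ∈ s, u i n) = ∑ i ∈ s, ev t (u i) := by
  rw [ev_eq_sum (N := N) (fun n hn => Finset.sum_eq_zero fun i hi => hu i hi n hn),
    Finset.sum_congr rfl fun i hi => ev_eq_sum (hu i hi) t, Finset.sum_comm]
  simp [Finset.smul_sum]

theorem ev_smul (c : ℂ) {u : ℕ → V} {N : ℕ} (hu : ∀ n, N ≤ n → u n = 0) (t : ℂ) :
    ev t (fun n => c • u n) = c • ev t u :=
  (map_ev (LinearMap.lsmul ℂ V c) hu t).symm

theorem ev_comm {w : ℕ → ℕ → V} {N : ℕ} (hw : ∀ i j, N ≤ i ∨ N ≤ j → w i j = 0) (s t : ℂ) :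
    ev s (fun i => ev t (w i)) = ev t fun j => ev s fun i => w i j := by
  have h1 : ∀ i, ev t (w i) = ∑ j ∈ Finset.range N, t ^ j • w i j := fun i =>
    ev_eq_sum (fun j hj => hw i j (Or.inr hj)) t
  have h2 : ∀ j, ev s (fun i => w i j) = ∑ i ∈ Finset.range N, s ^ i • w i j := fun j =>
    ev_eq_sum (fun i hi => hw i j (Or.inl hi)) s
  simp only [h1, h2]
  rw [ev_eq_sum (N := N) (fun i hi => Finset.sum_eq_zero fun j _ => by simp [hw i j (Or.inl hi)]),
    ev_eq_sum (N := N) (fun j hj => Finset.sum_eq_zero fun i _ => by simp [hw i j (Or.inr hj)])]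
  simp only [Finset.smul_sum]
  rw [Finset.sum_comm]
  exact Finset.sum_congr rfl fun j _ => Finset.sum_congr rfl fun i _ => smul_comm _ _ _

theorem ev_shift {u : ℕ → V} {N : ℕ} (hu : ∀ n, N ≤ n → u n = 0) (t : ℂ) :
    ev t (fun n => if n = 0 then 0 else u (n - 1)) = t • ev t u := by
  rw [ev_eq_sum hu, ev_eq_sum (N := N + 1) (fun n hn => by
    rw [if_neg (by omega), hu _ (by omega)]), Finset.sum_range_succ']
  simp [Finset.smul_sum, pow_succ', mul_smul]

theorem eq_zero_of_ev {u : ℕ → V} {N : ℕ} (hu : ∀ n, N ≤ n → u n = 0)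
    (h : ∀ t, ev t u = 0) (n : ℕ) : u n = 0 := by
  rw [← Module.forall_dual_apply_eq_zero_iff ℂ]
  intro φ
  let p : Polynomial ℂ := ∑ i ∈ Finset.range N, Polynomial.monomial i (φ (u i))
  have hp : p = 0 := by
    refine Polynomial.funext fun t => ?_
    have := congrArg φ (h t)
    rw [ev_eq_sum hu] at this
    simpa [p, Polynomial.eval_finsetSum, mul_comm] using this
  by_cases hn : N ≤ n
  · rw [hu n hn, map_zero]
  · have := congrArg (fun q : Polynomial ℂ => q.coeff n) hp
    simpa [p, Polynomial.finsetSum_coeff, Polynomial.coeff_monomial, not_le.1 hn] using this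

theorem eq_zero_of_ev_ev {w : ℕ → ℕ → V} {N : ℕ} (hw : ∀ i j, N ≤ i ∨ N ≤ j → w i j = 0)
    (h : ∀ s t, ev s (fun i => ev t (w i)) = 0) (i j : ℕ) : w i j = 0 :=
  eq_zero_of_ev (fun j hj => hw i j (Or.inr hj)) (fun t =>
    eq_zero_of_ev (N := N) (u := fun i => ev t (w i)) (fun i hi => by
      rw [show w i = fun _ => 0 from funext fun j => hw i j (Or.inl hi), ev_zero])
      (fun s => h s t) i) j

theorem ev_antidiagonal {w : ℕ → ℕ → V} {N : ℕ} (hw : ∀ i j, N ≤ i ∨ N ≤ j → w i j = 0) (t : ℂ) :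
    ev t (fun a => ∑ x ∈ Finset.HasAntidiagonal.antidiagonal a, w x.1 x.2) = ev t fun p => ev t (w p) := by
  have h1 : ∀ i, ev t (w i) = ∑ j ∈ Finset.range N, t ^ j • w i j := fun i =>
    ev_eq_sum (fun j hj => hw i j (Or.inr hj)) t
  simp only [h1]
  rw [ev_eq_sum (N := N + N) (fun a ha => Finset.sum_eq_zero fun x hx => by
      rw [Finset.HasAntidiagonal.mem_antidiagonal] at hx
      exact hw _ _ (by omega)),
    ev_eq_sum (N := N) (fun i hi => Finset.sum_eq_zero fun j _ => by simp [hw i j (Or.inl hi)])]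
  simp only [Finset.smul_sum, smul_smul, ← pow_add]
  rw [← sum_range_antidiagonal (M := N + N) (G := fun p q => t ^ (p + q) • w p q)
    (fun p q h => by simp [hw p q h]) (fun p q h => by simp [hw p q (by omega)])]
  refine Finset.sum_congr rfl fun a _ => Finset.sum_congr rfl fun x hx => ?_
  rw [Finset.HasAntidiagonal.mem_antidiagonal.1 hx]

theorem ev_choose {y : ℕ → V} {N : ℕ} (hy : ∀ n, N ≤ n → y n = 0) (s t : ℂ) :
    ev s (fun p => ev t fun b => ((p + b).choose b : ℂ) • y (p + b)) = ev (s + t) y := by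
  have h1 : ∀ p, ev t (fun b => ((p + b).choose b : ℂ) • y (p + b))
      = ∑ b ∈ Finset.range N, t ^ b • ((p + b).choose b : ℂ) • y (p + b) := fun p =>
    ev_eq_sum (fun b hb => by rw [hy _ (by omega), smul_zero]) t
  simp only [h1]
  rw [ev_eq_sum hy, ev_eq_sum (N := N) (fun i hi => Finset.sum_eq_zero fun j _ => by
    rw [hy _ (by omega), smul_zero, smul_zero])]
  simp only [Finset.smul_sum]
  rw [← sum_range_antidiagonal (M := N)
    (G := fun p b => s ^ p • t ^ b • ((p + b).choose b : ℂ) • y (p + b))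
    (fun p q h => by simp [hy (p + q) (by omega)]) (fun p q h => by simp [hy _ h])]
  refine Finset.sum_congr rfl fun a _ => ?_
  rw [add_comm s t, (Commute.all t s).add_pow', Finset.sum_smul, ← Finset.Nat.sum_antidiagonal_swap]
  refine Finset.sum_congr rfl fun x hx => ?_
  rw [Finset.HasAntidiagonal.mem_antidiagonal] at hx
  simp only [Prod.fst_swap, Prod.snd_swap, smul_smul, nsmul_eq_mul]
  rw [add_comm x.2, hx]
  congr 1
  ring

/-- Substituting `e s + t` in one variable and `s` in the other. -/
theorem ev_ev_subst {w : ℕ → ℕ → V} {N : ℕ} (hw : ∀ i j, N ≤ i ∨ N ≤ j → w i j = 0) (e : ℤ)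
    (s t : ℂ) :
    ev s (fun a => ev t fun b => ∑ x ∈ Finset.HasAntidiagonal.antidiagonal a,
        (e ^ x.1 * ((x.1 + b).choose b : ℤ)) • w (x.1 + b) x.2)
      = ev s fun q => ev (e * s + t) fun k => w k q := by
  have h1 : ∀ p q, ev t (fun b => (e ^ p * ((p + b).choose b : ℤ)) • w (p + b) q)
      = (e : ℂ) ^ p • ev t fun b => ((p + b).choose b : ℂ) • w (p + b) q := fun p q => by
    rw [← ev_smul _ (N := N) (fun b hb => by rw [hw _ _ (Or.inl (by omega)), smul_zero])]
    congr 1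
    funext b
    rw [smul_smul, ← Int.cast_smul_eq_zsmul ℂ]
    push_cast
    rfl
  have h0 : ∀ p q, N ≤ p ∨ N ≤ q →
      ev t (fun b => (e ^ p * ((p + b).choose b : ℤ)) • w (p + b) q) = 0 := fun p q h => by
    rw [← ev_zero t]
    congr 1
    funext b
    rw [hw _ _ (by omega), smul_zero]
  have h2 : ∀ a, (ev t fun b => ∑ x ∈ Finset.HasAntidiagonal.antidiagonal a,
        (e ^ x.1 * ((x.1 + b).choose b : ℤ)) • w (x.1 + b) x.2)
      = ∑ x ∈ Finset.HasAntidiagonal.antidiagonal a,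
        ev t (fun b => (e ^ x.1 * ((x.1 + b).choose b : ℤ)) • w (x.1 + b) x.2) := fun a =>
    ev_sum (N := N) _ (fun x _ b hb => by rw [hw _ _ (Or.inl (by omega)), smul_zero]) t
  simp only [h2]
  rw [ev_antidiagonal (N := N)
    (w := fun p q => ev t (fun b => (e ^ p * ((p + b).choose b : ℤ)) • w (p + b) q)) h0,
    ev_comm (N := N) h0]
  congr 1
  funext q
  rw [← ev_choose (N := N) (fun k hk => hw k q (Or.inl hk))]
  simp only [h1]
  unfold ev
  refine finsum_congr fun p => ?_
  rw [smul_smul, mul_pow, mul_comm]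

end Eval

theorem exists_joint_bound {M : Type*} [Zero M] {w : ℕ → ℕ → M}
    (h1 : ∃ N, ∀ i, N ≤ i → ∀ j, w i j = 0)
    (h2 : ∀ i, ∃ N, ∀ j, N ≤ j → w i j = 0) : ∃ N, ∀ i j, N ≤ i ∨ N ≤ j → w i j = 0 := by
  obtain ⟨N, hN⟩ := h1
  choose B hB using h2
  refine ⟨max N ((Finset.range N).sup B), fun i j h => ?_⟩
  by_cases hi : N ≤ i
  · exact hN i hi j
  · refine hB i j (le_trans (Finset.le_sup (f := B) (Finset.mem_range.2 (not_le.1 hi))) ?_)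
    rcases h with h | h
    · exact absurd (le_trans (le_max_left _ _) h) hi
    · exact le_trans (le_max_right _ _) h

theorem cbr_eq_antidiagonal {M : Type*} [AddCommGroup M] (f g : M → ℕ → M)
    (a : ℕ) (x : M) (b : ℕ) :
    cbr f g a x b = ∑ y ∈ Finset.HasAntidiagonal.antidiagonal a,
      ((-1 : ℤ) ^ y.1 * ((y.1 + b).choose b : ℤ)) •
        (f (g x (y.1 + b)) y.2 - g (f x y.2) (y.1 + b)) :=
  (Finset.Nat.sum_antidiagonal_eq_sum_range_succ (fun p q =>
    ((-1 : ℤ) ^ p * ((p + b).choose b : ℤ)) • (f (g x (p + b)) q - g (f x q) (p + b))) a).symm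

section Bracket

variable {M : Type*} [AddCommGroup M] [Module ℂ M] {D : M →ₗ[ℂ] M} {f g k : M → ℕ → M}

/-- The conformal endomorphisms, as a subspace of all coefficient families. -/
def chSubmodule (D : M →ₗ[ℂ] M) : Submodule ℂ (M → ℕ → M) where
  carrier := {f | IsCH D D f}
  zero_mem' := ⟨by simp, by simp, by simp, fun _ => ⟨0, by simp⟩⟩
  add_mem' := by
    rintro f g ⟨f1, f2, f3, f4⟩ ⟨g1, g2, g3, g4⟩
    refine ⟨fun x y n => ?_, fun c x n => ?_, fun x n => ?_, fun x => ?_⟩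
    · simp only [Pi.add_apply, f1, g1]
      abel
    · simp only [Pi.add_apply, f2, g2, smul_add]
    · simp only [Pi.add_apply, f3, g3, map_add]
      split_ifs <;> abel
    · obtain ⟨N, hN⟩ := f4 x
      obtain ⟨N', hN'⟩ := g4 x
      exact ⟨max N N', fun n hn => by
        simp [hN n (le_trans (le_max_left _ _) hn), hN' n (le_trans (le_max_right _ _) hn)]⟩
  smul_mem' := by
    rintro c f ⟨f1, f2, f3, f4⟩
    refine ⟨fun x y n => ?_, fun c x n => ?_, fun x n => ?_, fun x => ?_⟩
    · simp only [Pi.smul_apply, f1, smul_add]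
    · simp only [Pi.smul_apply, f2]
      exact smul_comm _ _ _
    · simp only [Pi.smul_apply, f3, map_smul, smul_add]
      split_ifs <;> simp
    · obtain ⟨N, hN⟩ := f4 x
      exact ⟨N, fun n hn => by simp [hN n hn]⟩

/-- The `n`-th coefficient of a conformal linear map, as a linear map. -/
def IsCH.coeff (hf : IsCH D D f) (n : ℕ) : M →ₗ[ℂ] M where
  toFun x := f x n
  map_add' x y := hf.1 x y n
  map_smul' c x := hf.2.1 c x n

theorem IsCH.map_sub (hf : IsCH D D f) (x y : M) (n : ℕ) : f (x - y) n = f x n - f y n :=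
  _root_.map_sub (hf.coeff n) x y

theorem IsCH.map_zero (hf : IsCH D D f) (n : ℕ) : f 0 n = 0 := _root_.map_zero (hf.coeff n)

/-- The value `f_t` of a conformal linear map at a number `t`, as a linear map. -/
def IsCH.eval (hf : IsCH D D f) (t : ℂ) : M →ₗ[ℂ] M where
  toFun x := ev t (f x)
  map_add' x y := by
    obtain ⟨N, hN⟩ := hf.2.2.2 x
    obtain ⟨N', hN'⟩ := hf.2.2.2 y
    rw [← ev_add (N := max N N') (fun n hn => hN n (le_trans (le_max_left _ _) hn))
      (fun n hn => hN' n (le_trans (le_max_right _ _) hn))]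
    exact congrArg (ev t) (funext fun n => hf.1 x y n)
  map_smul' c x := by
    obtain ⟨N, hN⟩ := hf.2.2.2 x
    rw [RingHom.id_apply, ← ev_smul c hN]
    exact congrArg (ev t) (funext fun n => hf.2.1 c x n)

theorem IsCH.eval_apply (hf : IsCH D D f) (t : ℂ) (x : M) : hf.eval t x = ev t (f x) := rfl

theorem IsCH.eval_D (hf : IsCH D D f) (t : ℂ) (x : M) :
    hf.eval t (D x) = D (hf.eval t x) + t • hf.eval t x := by
  obtain ⟨N, hN⟩ := hf.2.2.2 x
  simp only [IsCH.eval_apply]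
  rw [map_ev D hN, ← ev_shift hN, ← ev_add (N := N + 1)
    (fun n hn => by rw [hN n (by omega), _root_.map_zero])
    (fun n hn => by rw [if_neg (by omega), hN _ (by omega)])]
  exact congrArg (ev t) (funext fun n => hf.2.2.1 x n)

theorem IsCH.exists_bound_comp (hf : IsCH D D f) (hg : IsCH D D g) (x : M) :
    ∃ N, ∀ i j, N ≤ i ∨ N ≤ j → f (g x i) j = 0 := by
  refine exists_joint_bound ?_ fun i => hf.2.2.2 _
  obtain ⟨N, hN⟩ := hg.2.2.2 x
  exact ⟨N, fun i hi j => by rw [hN i hi, hf.map_zero]⟩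

theorem IsCH.exists_bound_sub (hf : IsCH D D f) (hg : IsCH D D g) (x : M) :
    ∃ N, ∀ i j, N ≤ i ∨ N ≤ j → f (g x i) j = 0 ∧ g (f x j) i = 0 := by
  obtain ⟨N, hN⟩ := hf.exists_bound_comp hg x
  obtain ⟨N', hN'⟩ := hg.exists_bound_comp hf x
  exact ⟨max N N', fun i j h => ⟨hN i j (by omega), hN' j i (by omega)⟩⟩

theorem IsCH.exists_bound_cbr (hf : IsCH D D f) (hg : IsCH D D g) (x : M) :
    ∃ N, ∀ a b, N ≤ a ∨ N ≤ b → cbr f g a x b = 0 := by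
  obtain ⟨N, hN⟩ := hf.exists_bound_sub hg x
  refine ⟨N + N, fun a b h => ?_⟩
  rw [cbr_eq_antidiagonal]
  refine Finset.sum_eq_zero fun y hy => ?_
  rw [Finset.HasAntidiagonal.mem_antidiagonal] at hy
  obtain ⟨h1, h2⟩ := hN (y.1 + b) y.2 (by omega)
  rw [h1, h2, sub_zero, smul_zero]

/-- `[f_s g]_t = f_s g_{t-s} - g_{t-s} f_s` for numbers `s`, `t`. -/
theorem IsCH.ev_ev_cbr (hf : IsCH D D f) (hg : IsCH D D g) (s t : ℂ) (x : M) :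
    ev s (fun a => ev t (cbr f g a x))
      = hf.eval s (hg.eval (t - s) x) - hg.eval (t - s) (hf.eval s x) := by
  obtain ⟨N, hN⟩ := hf.exists_bound_sub hg x
  have hc : ∀ a, cbr f g a x = fun b => ∑ y ∈ Finset.HasAntidiagonal.antidiagonal a,
      ((-1 : ℤ) ^ y.1 * ((y.1 + b).choose b : ℤ)) •
        (f (g x (y.1 + b)) y.2 - g (f x y.2) (y.1 + b)) := fun a =>
    funext fun b => cbr_eq_antidiagonal f g a x b
  simp only [hc]
  rw [ev_ev_subst (w := fun i j => f (g x i) j - g (f x j) i) (N := N)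
    (fun i j h => by rw [(hN i j h).1, (hN i j h).2, sub_zero])]
  have hst : ((-1 : ℤ) : ℂ) * s + t = t - s := by
    push_cast
    ring
  rw [hst]
  have h1 : ∀ q, ev (t - s) (fun i => f (g x i) q - g (f x q) i)
      = ev (t - s) (fun i => f (g x i) q) - ev (t - s) (fun i => g (f x q) i) := fun q =>
    ev_sub (N := N) (fun i hi => (hN i q (Or.inl hi)).1) (fun i hi => (hN i q (Or.inl hi)).2) _
  simp only [h1]
  have hz : ∀ {u : ℕ → M}, (∀ i, u i = 0) → ev (t - s) u = 0 := fun {u} hu => by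
    rw [show u = fun _ => 0 from funext hu, ev_zero]
  rw [ev_sub (N := N) (fun q hq => hz fun i => (hN i q (Or.inr hq)).1)
    (fun q hq => hz fun i => (hN i q (Or.inr hq)).2),
    ← ev_comm (N := N) (fun i j h => (hN i j h).1)]
  obtain ⟨Nf, hNf⟩ := hf.2.2.2 x
  obtain ⟨Ng, hNg⟩ := hg.2.2.2 x
  rw [hg.eval_apply (t - s) x, map_ev _ hNg, hf.eval_apply s x, map_ev _ hNf]
  rfl

theorem IsCH.cbr (hf : IsCH D D f) (hg : IsCH D D g) (a : ℕ) : IsCH D D (cbr f g a) := by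
  refine ⟨fun x y n => ?_, fun c x n => ?_, fun x n => ?_, fun x => ?_⟩
  · simp only [CE.cbr, hf.1, hg.1, ← Finset.sum_add_distrib, ← smul_add]
    refine Finset.sum_congr rfl fun p _ => ?_
    congr 1
    abel
  · simp only [CE.cbr, hf.2.1, hg.2.1, ← smul_sub, Finset.smul_sum]
    exact Finset.sum_congr rfl fun p _ => smul_comm _ _ _
  · obtain ⟨N, hN⟩ := hf.exists_bound_cbr hg x
    obtain ⟨N', hN'⟩ := hf.exists_bound_cbr hg (D x)
    have hsh : ∀ a b, N + N' + 1 ≤ a ∨ N + N' + 1 ≤ b →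
        (if b = 0 then 0 else CE.cbr f g a x (b - 1)) = 0 := fun a b h => by
      split_ifs
      · rfl
      · exact hN _ _ (by omega)
    have hD : ∀ a b, N + N' + 1 ≤ a ∨ N + N' + 1 ≤ b → D (CE.cbr f g a x b) = 0 := fun a b h => by
      rw [hN a b (by omega), _root_.map_zero]
    have hDx : ∀ a b, N + N' + 1 ≤ a ∨ N + N' + 1 ≤ b → CE.cbr f g a (D x) b = 0 :=
      fun a b h => hN' a b (by omega)
    have hz : ∀ t {u : ℕ → M}, (∀ i, u i = 0) → ev t u = 0 := fun t {u} hu => by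
      rw [show u = fun _ => 0 from funext hu, ev_zero]
    rw [← sub_eq_zero]
    refine eq_zero_of_ev_ev (N := N + N' + 1)
      (w := fun a b => CE.cbr f g a (D x) b -
        (D (CE.cbr f g a x b) + if b = 0 then 0 else CE.cbr f g a x (b - 1)))
      (fun a b h => by simp only [hsh a b h, hD a b h, hDx a b h, add_zero, sub_zero])
      (fun s t => ?_) a n
    have h1 : ∀ a, ev t (fun b => CE.cbr f g a (D x) b -
        (D (CE.cbr f g a x b) + if b = 0 then 0 else CE.cbr f g a x (b - 1)))
        = ev t (CE.cbr f g a (D x)) - (D (ev t (CE.cbr f g a x)) + t • ev t (CE.cbr f g a x)) :=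
      fun a => by
        have hb : ∀ b, N ≤ b → CE.cbr f g a x b = 0 := fun b hb => hN a b (Or.inr hb)
        rw [map_ev D hb, ← ev_shift hb, ← ev_add (N := N + N' + 1)
          (fun b hb => hD a b (Or.inr hb)) (fun b hb => hsh a b (Or.inr hb)),
          ← ev_sub (N := N + N' + 1) (fun b hb => hDx a b (Or.inr hb))
          (fun b hb => by rw [hD a b (Or.inr hb), hsh a b (Or.inr hb), add_zero])]
    simp only [h1]
    have hx : ∀ a, N + N' + 1 ≤ a → ev t (CE.cbr f g a x) = 0 := fun a ha =>
      hz t fun b => hN a b (by omega)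
    rw [ev_sub (N := N + N' + 1) (fun a ha => hz t fun b => hDx a b (Or.inl ha))
      (fun a ha => by rw [hx a ha, _root_.map_zero, smul_zero, add_zero]),
      ev_add (N := N + N' + 1) (fun a ha => by rw [hx a ha, _root_.map_zero])
      (fun a ha => by rw [hx a ha, smul_zero]), ← map_ev D hx, ev_smul t hx,
      hf.ev_ev_cbr hg, hf.ev_ev_cbr hg]
    simp only [IsCH.eval_D, map_add, _root_.map_sub, map_smul, smul_sub]
    module
  · obtain ⟨N, hN⟩ := hf.exists_bound_cbr hg x
    exact ⟨N, fun n hn => hN a n (Or.inr hn)⟩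

theorem IsCH.Dch (hf : IsCH D D f) : IsCH D D (Dch f) := by
  refine ⟨fun x y n => ?_, fun c x n => ?_, fun x n => ?_, fun x => ?_⟩
  · cases n with
    | zero => simp [CE.Dch]
    | succ n =>
      simp only [CE.Dch, hf.1]
      abel
  · cases n with
    | zero => simp [CE.Dch]
    | succ n => simp [CE.Dch, hf.2.1]
  · cases n with
    | zero => simp [CE.Dch]
    | succ n =>
      cases n with
      | zero => simp [CE.Dch, hf.2.2.1]
      | succ n =>
        simp [CE.Dch, hf.2.2.1]
        abel
  · obtain ⟨N, hN⟩ := hf.2.2.2 x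
    refine ⟨N + 1, fun n hn => ?_⟩
    cases n with
    | zero => rfl
    | succ n => simp [CE.Dch, hN n (by omega)]

theorem Dch_apply (f : M → ℕ → M) (x : M) (n : ℕ) :
    Dch f x n = (-1 : ℂ) • (if n = 0 then 0 else f x (n - 1)) := by
  cases n <;> simp [Dch]

theorem IsCH.ev_Dch (hf : IsCH D D f) (t : ℂ) (x : M) :
    ev t (CE.Dch f x) = -(t • ev t (f x)) := by
  obtain ⟨N, hN⟩ := hf.2.2.2 x
  rw [show CE.Dch f x = _ from funext fun n => Dch_apply f x n,
    ev_smul (N := N + 1) _ (fun n hn => by rw [if_neg (by omega), hN _ (by omega)]), ev_shift hN,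
    neg_one_smul]

theorem IsCH.eval_Dch (hf : IsCH D D f) (t : ℂ) (x : M) :
    hf.Dch.eval t x = -(t • hf.eval t x) := hf.ev_Dch t x

theorem IsCH.cbr_Dch_left (hg : IsCH D D g) (f : M → ℕ → M) (a : ℕ) (x : M) (b : ℕ) :
    CE.cbr (CE.Dch f) g a x b = -(if a = 0 then 0 else CE.cbr f g (a - 1) x b) := by
  cases a with
  | zero => simp [CE.cbr, CE.Dch, hg.map_zero]
  | succ a =>
    rw [if_neg (Nat.succ_ne_zero a), Nat.add_sub_cancel]
    simp only [CE.cbr]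
    rw [Finset.sum_range_succ, ← Finset.sum_neg_distrib]
    simp only [Nat.sub_self, CE.Dch, hg.map_zero, sub_zero, smul_zero, add_zero]
    refine Finset.sum_congr rfl fun p hp => ?_
    rw [Nat.succ_sub (Nat.lt_succ_iff.1 (Finset.mem_range.1 hp)), ← smul_neg]
    congr 1
    have : g (-f x (a - p)) (p + b) = -g (f x (a - p)) (p + b) :=
      map_neg (hg.coeff (p + b)) _
    simp only [this]
    abel

theorem IsCH.cbr_Dch_right (hf : IsCH D D f) (hg : IsCH D D g) (a : ℕ) (x : M) (b : ℕ) :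
    CE.cbr f (CE.Dch g) a x b
      = CE.Dch (CE.cbr f g a) x b + (if a = 0 then 0 else CE.cbr f g (a - 1) x b) := by
  obtain ⟨N, hN⟩ := hf.exists_bound_cbr hg x
  obtain ⟨N', hN'⟩ := hf.exists_bound_cbr hg.Dch x
  have hsh : ∀ a b, N + N' + 1 ≤ a ∨ N + N' + 1 ≤ b →
      (if a = 0 then 0 else CE.cbr f g (a - 1) x b) = 0 := fun a b h => by
    split_ifs
    · rfl
    · exact hN _ _ (by omega)
  have hD : ∀ a b, N + N' + 1 ≤ a ∨ N + N' + 1 ≤ b → CE.Dch (CE.cbr f g a) x b = 0 :=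
    fun a b h => by
      rw [Dch_apply]
      split_ifs
      · simp
      · rw [hN _ _ (by omega), smul_zero]
  have hl : ∀ a b, N + N' + 1 ≤ a ∨ N + N' + 1 ≤ b → CE.cbr f (CE.Dch g) a x b = 0 :=
    fun a b h => hN' a b (by omega)
  have hz : ∀ t {u : ℕ → M}, (∀ i, u i = 0) → ev t u = 0 := fun t {u} hu => by
    rw [show u = fun _ => 0 from funext hu, ev_zero]
  rw [← sub_eq_zero]
  refine eq_zero_of_ev_ev (N := N + N' + 1)
    (w := fun a b => CE.cbr f (CE.Dch g) a x b -
      (CE.Dch (CE.cbr f g a) x b + if a = 0 then 0 else CE.cbr f g (a - 1) x b))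
    (fun a b h => by simp only [hsh a b h, hD a b h, hl a b h, add_zero, sub_zero])
    (fun s t => ?_) a b
  have hx : ∀ a, N + N' + 1 ≤ a → ev t (CE.cbr f g a x) = 0 := fun a ha =>
    hz t fun b => hN a b (by omega)
  have h1 : ∀ a, ev t (fun b => CE.cbr f (CE.Dch g) a x b -
        (CE.Dch (CE.cbr f g a) x b + if a = 0 then 0 else CE.cbr f g (a - 1) x b))
      = ev t (CE.cbr f (CE.Dch g) a x) - ((-t) • ev t (CE.cbr f g a x)
        + if a = 0 then 0 else ev t (CE.cbr f g (a - 1) x)) := fun a => by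
    rw [ev_sub (N := N + N' + 1) (fun b hb => hl a b (Or.inr hb))
      (fun b hb => by rw [hD a b (Or.inr hb), hsh a b (Or.inr hb), add_zero]),
      ev_add (N := N + N' + 1) (fun b hb => hD a b (Or.inr hb)) (fun b hb => hsh a b (Or.inr hb)),
      (hf.cbr hg a).ev_Dch, neg_smul]
    congr 2
    split_ifs
    · exact ev_zero t
    · rfl
  simp only [h1]
  rw [ev_sub (N := N + N' + 1 + 1) (fun a ha => hz t fun b => hl a b (Or.inl (by omega)))
    (fun a ha => by rw [hx a (by omega), smul_zero, if_neg (by omega), hx _ (by omega), add_zero]),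
    ev_add (N := N + N' + 1 + 1) (fun a ha => by rw [hx a (by omega), smul_zero])
    (fun a ha => by rw [if_neg (by omega), hx _ (by omega)]), ev_smul (-t) hx, ev_shift hx,
    hf.ev_ev_cbr hg, hf.ev_ev_cbr hg.Dch]
  rw [hg.eval_Dch, hg.eval_Dch, map_neg, map_smul]
  module

theorem FinPart.exists_bound (hD : FinPart D) {u : ℕ → M → ℕ → M} (hu : ∀ j, IsCH D D (u j))
    (hx : ∀ x, ∃ N, ∀ j, N ≤ j → ∀ b, u j x b = 0) : ∃ N, ∀ j, N ≤ j → u j = 0 := by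
  obtain ⟨n, y, hy⟩ := hD
  choose B hB using hx
  refine ⟨Finset.univ.sup fun i => B (y i), fun j hj => funext fun x => funext fun b => ?_⟩
  have hpow : ∀ i m b, u j ((D ^ m) (y i)) b = 0 := by
    intro i m
    induction m with
    | zero =>
      exact hB (y i) j (le_trans (Finset.le_sup (f := fun i => B (y i)) (Finset.mem_univ i)) hj)
    | succ m ih =>
      intro b
      rw [pow_succ', Module.End.mul_apply, (hu j).2.2.1, ih]
      split_ifs <;> simp [ih]
  have hle : Submodule.span ℂ (Set.range fun p : Fin n × ℕ => (D ^ p.2) (y p.1))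
      ≤ LinearMap.ker ((hu j).coeff b) := by
    rw [Submodule.span_le]
    rintro _ ⟨⟨i, m⟩, rfl⟩
    exact hpow i m b
  exact hle (hy x)

theorem IsCH.exists_uniform_bound (hD : FinPart D) (hf : IsCH D D f) (hg : IsCH D D g) :
    ∃ N, ∀ j, N ≤ j → CE.cbr f g j = 0 :=
  hD.exists_bound (fun j => hf.cbr hg j) fun x => by
    obtain ⟨N, hN⟩ := hf.exists_bound_cbr hg x
    exact ⟨N, fun j hj b => hN j b (Or.inl hj)⟩

theorem IsCH.ev {u : ℕ → M → ℕ → M} {N : ℕ} (hN : ∀ j, N ≤ j → u j = 0)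
    (hu : ∀ j, IsCH D D (u j)) (s : ℂ) : IsCH D D (ev s u) := by
  rw [ev_eq_sum hN]
  exact (chSubmodule D).sum_mem fun j _ => (chSubmodule D).smul_mem _ (hu j)

theorem ev_apply {u : ℕ → M → ℕ → M} {N : ℕ} (hN : ∀ j, N ≤ j → u j = 0) (s : ℂ) (x : M)
    (b : ℕ) : ev s u x b = ev s fun a => u a x b :=
  map_ev (LinearMap.proj b ∘ₗ LinearMap.proj x) hN s

theorem ev_ev_apply {u : ℕ → M → ℕ → M} {N : ℕ} (hN : ∀ j, N ≤ j → u j = 0)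
    (hu : ∀ j, IsCH D D (u j)) (s t : ℂ) (x : M) :
    ev t (ev s u x) = ev s fun a => ev t (u a x) := by
  obtain ⟨N', hN'⟩ := exists_joint_bound (w := fun a => u a x)
    ⟨N, fun a ha b => by rw [hN a ha]; rfl⟩ fun a => (hu a).2.2.2 x
  rw [ev_comm hN']
  exact congrArg (CE.ev t) (funext fun b => ev_apply hN s x b)

theorem IsCH.ev_bracket {N : ℕ} (hf : IsCH D D f) (hg : IsCH D D g)
    (hN : ∀ j, N ≤ j → CE.cbr f g j = 0) (s t : ℂ) (x : M) :
    CE.ev t (CE.ev s (CE.cbr f g) x)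
      = hf.eval s (hg.eval (t - s) x) - hg.eval (t - s) (hf.eval s x) := by
  rw [ev_ev_apply hN (fun j => hf.cbr hg j), hf.ev_ev_cbr hg]

theorem IsCH.eq_zero (hf : IsCH D D f) (h : ∀ t x, CE.ev t (f x) = 0) : f = 0 := by
  funext x b
  obtain ⟨N, hN⟩ := hf.2.2.2 x
  exact eq_zero_of_ev hN (fun t => h t x) b

/-- The bracket is linear in its second argument. -/
def IsCH.cbrRight (hf : IsCH D D f) (a : ℕ) : (M → ℕ → M) →ₗ[ℂ] (M → ℕ → M) where
  toFun g := CE.cbr f g a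
  map_add' g k := by
    funext x b
    simp only [CE.cbr, Pi.add_apply, hf.1, ← Finset.sum_add_distrib, ← smul_add]
    refine Finset.sum_congr rfl fun p _ => ?_
    congr 1
    abel
  map_smul' c g := by
    funext x b
    simp only [CE.cbr, Pi.smul_apply, hf.2.1, RingHom.id_apply, ← smul_sub, Finset.smul_sum]
    exact Finset.sum_congr rfl fun p _ => smul_comm _ _ _

/-- The bracket is linear in its first argument. -/
def IsCH.cbrLeft (hg : IsCH D D g) (a : ℕ) : (M → ℕ → M) →ₗ[ℂ] (M → ℕ → M) where
  toFun f := CE.cbr f g a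
  map_add' f k := by
    funext x b
    simp only [CE.cbr, Pi.add_apply, hg.1, ← Finset.sum_add_distrib, ← smul_add]
    refine Finset.sum_congr rfl fun p _ => ?_
    congr 1
    abel
  map_smul' c f := by
    funext x b
    simp only [CE.cbr, Pi.smul_apply, hg.2.1, RingHom.id_apply, ← smul_sub, Finset.smul_sum]
    exact Finset.sum_congr rfl fun p _ => smul_comm _ _ _

theorem IsCH.cbr_zero_right (hf : IsCH D D f) (a : ℕ) : CE.cbr f 0 a = 0 :=
  _root_.map_zero (hf.cbrRight a)

theorem IsCH.cbr_zero_left (hg : IsCH D D g) (a : ℕ) : CE.cbr 0 g a = 0 :=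
  _root_.map_zero (hg.cbrLeft a)

theorem IsCH.cbr_ev_right (hf : IsCH D D f) {u : ℕ → M → ℕ → M} {N : ℕ}
    (hN : ∀ j, N ≤ j → u j = 0) (t : ℂ) (a : ℕ) :
    CE.cbr f (CE.ev t u) a = CE.ev t fun n => CE.cbr f (u n) a :=
  map_ev (hf.cbrRight a) hN t

theorem IsCH.cbr_ev_left (hg : IsCH D D g) {u : ℕ → M → ℕ → M} {N : ℕ}
    (hN : ∀ j, N ≤ j → u j = 0) (t : ℂ) (a : ℕ) :
    CE.cbr (CE.ev t u) g a = CE.ev t fun n => CE.cbr (u n) g a :=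
  map_ev (hg.cbrLeft a) hN t

theorem substSum_eq_antidiagonal {V : Type*} [AddCommGroup V] (F : ℕ → ℕ → V) (m n : ℕ) :
    substSum F m n = ∑ x ∈ Finset.HasAntidiagonal.antidiagonal m,
      ((1 : ℤ) ^ x.1 * ((x.1 + n).choose n : ℤ)) • F x.2 (x.1 + n) := by
  rw [← Finset.Nat.sum_antidiagonal_swap]
  simp only [Prod.fst_swap, Prod.snd_swap, one_pow, one_mul, natCast_zsmul]
  exact (Finset.Nat.sum_antidiagonal_eq_sum_range_succ
    (fun p q => (q + n).choose n • F p (q + n)) m).symm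

theorem ev_ev_substSum {V : Type*} [AddCommGroup V] [Module ℂ V] {F : ℕ → ℕ → V} {N : ℕ}
    (hF : ∀ i j, N ≤ i ∨ N ≤ j → F i j = 0) (s t : ℂ) :
    ev s (fun m => ev t (substSum F m)) = ev s fun j => ev (s + t) (F j) := by
  have h := ev_ev_subst (w := fun i j => F j i) (N := N) (fun i j h => hF j i h.symm) 1 s t
  rw [Int.cast_one, one_mul] at h
  rw [← h]
  simp only [← substSum_eq_antidiagonal]

theorem substSum_eq_zero {V : Type*} [AddCommGroup V] {F : ℕ → ℕ → V} {N : ℕ}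
    (hF : ∀ i j, N ≤ i ∨ N ≤ j → F i j = 0) (m n : ℕ) (h : N + N ≤ m ∨ N + N ≤ n) :
    substSum F m n = 0 := by
  rw [substSum_eq_antidiagonal]
  refine Finset.sum_eq_zero fun x hx => ?_
  rw [Finset.HasAntidiagonal.mem_antidiagonal] at hx
  rw [hF _ _ (by omega), smul_zero]

theorem substSum_apply {M : Type*} [AddCommMonoid M] (F : ℕ → ℕ → M → ℕ → M) (m n : ℕ) (x : M)
    (b : ℕ) : substSum F m n x b = substSum (fun j s => F j s x b) m n := by
  simp [substSum, Finset.sum_apply]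

/-- The Jacobi identity for conformal endomorphisms. -/
theorem IsCH.jacobi (hD : FinPart D) (hf : IsCH D D f) (hg : IsCH D D g) (hk : IsCH D D k)
    (m n : ℕ) (x : M) (b : ℕ) :
    CE.cbr f (CE.cbr g k n) m x b
      = substSum (fun j s => CE.cbr (CE.cbr f g j) k s x b) m n
        + CE.cbr g (CE.cbr f k m) n x b := by
  obtain ⟨N₁, h₁⟩ := hg.exists_uniform_bound hD hk
  obtain ⟨N₂, h₂⟩ := hf.exists_uniform_bound hD hg
  obtain ⟨N₃, h₃⟩ := hf.exists_uniform_bound hD hk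
  obtain ⟨P₁, hP₁⟩ := exists_joint_bound (w := fun n m => CE.cbr f (CE.cbr g k n) m)
    ⟨N₁, fun n hn m => by rw [h₁ n hn, hf.cbr_zero_right]⟩
    fun n => hf.exists_uniform_bound hD (hg.cbr hk n)
  obtain ⟨P₂, hP₂⟩ := exists_joint_bound (w := fun j s => CE.cbr (CE.cbr f g j) k s)
    ⟨N₂, fun j hj s => by rw [h₂ j hj, hk.cbr_zero_left]⟩
    fun j => (hf.cbr hg j).exists_uniform_bound hD hk
  obtain ⟨P₃, hP₃⟩ := exists_joint_bound (w := fun m n => CE.cbr g (CE.cbr f k m) n)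
    ⟨N₃, fun m hm n => by rw [h₃ m hm, hg.cbr_zero_right]⟩
    fun m => hg.exists_uniform_bound hD (hf.cbr hk m)
  have hS := substSum_eq_zero hP₂
  let P := P₁ + (P₂ + P₂) + P₃
  have hz : ∀ t {u : ℕ → M → ℕ → M}, (∀ i, u i = 0) → CE.ev t u = 0 := fun t {u} hu => by
    rw [show u = fun _ => 0 from funext hu, ev_zero]
  have hw : ∀ m n, CE.cbr f (CE.cbr g k n) m
      - (substSum (fun j s => CE.cbr (CE.cbr f g j) k s) m n + CE.cbr g (CE.cbr f k m) n) = 0 := by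
    refine eq_zero_of_ev_ev (N := P) (fun m n h => ?_) fun s t => ?_
    · rw [hP₁ n m (by omega), hS m n (by omega), hP₃ m n (by omega), add_zero, sub_zero]
    · have e₁ : ∀ m, CE.ev t (fun n => CE.cbr f (CE.cbr g k n) m
          - (substSum (fun j s => CE.cbr (CE.cbr f g j) k s) m n + CE.cbr g (CE.cbr f k m) n))
          = CE.cbr f (CE.ev t (CE.cbr g k)) m
            - (CE.ev t (substSum (fun j s => CE.cbr (CE.cbr f g j) k s) m)
              + CE.ev t (CE.cbr g (CE.cbr f k m))) := fun m => by
        rw [ev_sub (N := P) (fun n hn => hP₁ n m (by omega)) (fun n hn => by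
            rw [hS m n (by omega), hP₃ m n (by omega), add_zero]),
          ev_add (N := P) (fun n hn => hS m n (by omega)) (fun n hn => hP₃ m n (by omega)),
          hf.cbr_ev_right h₁]
      have hB₁ := IsCH.ev h₁ (fun j => hg.cbr hk j) t
      have hB₂ := IsCH.ev h₂ (fun j => hf.cbr hg j) s
      have hB₃ := IsCH.ev h₃ (fun j => hf.cbr hk j) s
      obtain ⟨Q₁, hQ₁⟩ := hf.exists_uniform_bound hD hB₁
      obtain ⟨Q₂, hQ₂⟩ := hB₂.exists_uniform_bound hD hk
      obtain ⟨Q₃, hQ₃⟩ := hg.exists_uniform_bound hD hB₃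
      simp only [e₁]
      rw [ev_sub (N := P + Q₁) (fun m hm => hQ₁ m (by omega)) (fun m hm => by
          rw [hz t fun n => hS m n (by omega), hz t fun n => hP₃ m n (by omega), add_zero]),
        ev_add (N := P) (fun m hm => hz t fun n => hS m n (by omega))
          (fun m hm => hz t fun n => hP₃ m n (by omega)),
        ev_ev_substSum hP₂, ev_comm hP₂, ev_comm hP₃]
      simp only [← hk.cbr_ev_left h₂, ← hg.cbr_ev_right h₃]
      have c₁ := IsCH.ev hQ₁ (fun j => hf.cbr hB₁ j) s
      have c₂ := IsCH.ev hQ₂ (fun j => hB₂.cbr hk j) (s + t)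
      have c₃ := IsCH.ev hQ₃ (fun j => hg.cbr hB₃ j) t
      refine IsCH.eq_zero (D := D)
        ((chSubmodule D).sub_mem c₁ ((chSubmodule D).add_mem c₂ c₃)) fun r y => ?_
      obtain ⟨R₁, hR₁⟩ := c₁.2.2.2 y
      obtain ⟨R₂, hR₂⟩ := c₂.2.2.2 y
      obtain ⟨R₃, hR₃⟩ := c₃.2.2.2 y
      refine (ev_sub (N := R₁ + R₂ + R₃) (fun b hb => hR₁ b (by omega)) (fun b hb => ?_) r).trans ?_
      · exact (congrArg₂ (· + ·) (hR₂ b (by omega)) (hR₃ b (by omega))).trans (add_zero 0)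
      rw [sub_eq_zero]
      refine Eq.trans ?_ (ev_add (N := R₁ + R₂ + R₃) (fun b hb => hR₂ b (by omega))
        (fun b hb => hR₃ b (by omega)) r).symm
      rw [hf.ev_bracket hB₁ hQ₁, hB₂.ev_bracket hk hQ₂, hg.ev_bracket hB₃ hQ₃]
      simp only [hB₁.eval_apply, hB₂.eval_apply, hB₃.eval_apply, hg.ev_bracket hk h₁,
        hf.ev_bracket hg h₂, hf.ev_bracket hk h₃, _root_.map_sub]
      rw [show r - (s + t) = r - s - t by ring, show r - t - s = r - s - t by ring,
        show s + t - s = t by ring]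
      abel
  have := congrFun (congrFun (sub_eq_zero.1 (hw m n)) x) b
  rw [this, Pi.add_apply, Pi.add_apply, substSum_apply]

theorem IsCH.Dch_iterate (hf : IsCH D D f) (i : ℕ) :
    IsCH D D ((fun u : M → ℕ → M => CE.Dch u)^[i] f) := by
  induction i with
  | zero => exact hf
  | succ i ih =>
    rw [Function.iterate_succ_apply']
    exact ih.Dch

theorem IsCH.ev_Dch_iterate (hf : IsCH D D f) (i : ℕ) (t : ℂ) (x : M) :
    CE.ev t ((fun u : M → ℕ → M => CE.Dch u)^[i] f x) = (-t) ^ i • CE.ev t (f x) := by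
  induction i with
  | zero => simp
  | succ i ih =>
    rw [Function.iterate_succ_apply', (hf.Dch_iterate i).ev_Dch, ih, pow_succ', mul_smul, neg_smul]

/-- Skew-symmetry `[f_λ g] = -[g_{-∂-λ} f]` for conformal endomorphisms. -/
theorem IsCH.skew (hD : FinPart D) (hf : IsCH D D f) (hg : IsCH D D g) {N : ℕ}
    (hN : ∀ j, N ≤ j → CE.cbr g f j = 0) (a : ℕ) (x : M) (b : ℕ) :
    CE.cbr f g a x b = ∑ j ∈ Finset.range N, (((-1 : ℤ) ^ (j + 1)) * (j.choose a)) •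
      (((fun u : M → ℕ → M => CE.Dch u)^[j - a]) (CE.cbr g f j)) x b := by
  obtain ⟨N', hN'⟩ := hf.exists_uniform_bound hD hg
  let S : ℕ → M → ℕ → M := fun a => ∑ j ∈ Finset.range N,
    (((-1 : ℤ) ^ (j + 1) * (j.choose a) : ℤ) : ℂ) •
      ((fun u : M → ℕ → M => CE.Dch u)^[j - a]) (CE.cbr g f j)
  have hS : ∀ a, IsCH D D (S a) := fun a => (chSubmodule D).sum_mem fun j _ =>
    (chSubmodule D).smul_mem _ ((hg.cbr hf j).Dch_iterate _)
  have hS0 : ∀ a, N ≤ a → S a = 0 := fun a ha => Finset.sum_eq_zero fun j hj => by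
    rw [Finset.mem_range] at hj
    simp [Nat.choose_eq_zero_of_lt (lt_of_lt_of_le hj ha)]
  have hSev : ∀ t y a, CE.ev t (S a y) = ∑ j ∈ Finset.range N,
      ((-1 : ℂ) ^ (j + 1) * (j.choose a) * (-t) ^ (j - a)) • CE.ev t (CE.cbr g f j y) := by
    intro t y a
    have hu : ∀ j, ∃ B, ∀ b, B ≤ b →
        ((fun u : M → ℕ → M => CE.Dch u)^[j - a]) (CE.cbr g f j) y b = 0 := fun j =>
      ((hg.cbr hf j).Dch_iterate _).2.2.2 y
    choose B hB using hu
    have hSy : S a y = fun b => ∑ j ∈ Finset.range N,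
        (((-1 : ℤ) ^ (j + 1) * (j.choose a) : ℤ) : ℂ) •
          ((fun u : M → ℕ → M => CE.Dch u)^[j - a]) (CE.cbr g f j) y b := by
      funext b
      simp only [S, Finset.sum_apply, Pi.smul_apply]
    rw [hSy, ev_sum (N := (Finset.range N).sup B) _ fun j hj b hb => by
      rw [hB j b (le_trans (Finset.le_sup hj) hb), smul_zero]]
    refine Finset.sum_congr rfl fun j _ => ?_
    rw [ev_smul _ (hB j), (hg.cbr hf j).ev_Dch_iterate, smul_smul]
    push_cast
    rfl
  have h : ∀ a, CE.cbr f g a - S a = 0 := by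
    refine eq_zero_of_ev (N := N + N') (fun a ha => by
      rw [hN' a (by omega), hS0 a (by omega), sub_zero]) fun s => ?_
    rw [ev_sub (N := N + N') (fun a ha => hN' a (by omega)) (fun a ha => hS0 a (by omega))]
    have c₁ := IsCH.ev hN' (fun j => hf.cbr hg j) s
    have c₂ := IsCH.ev hS0 hS s
    refine IsCH.eq_zero (D := D) ((chSubmodule D).sub_mem c₁ c₂) fun t y => ?_
    obtain ⟨R₁, hR₁⟩ := c₁.2.2.2 y
    obtain ⟨R₂, hR₂⟩ := c₂.2.2.2 y
    refine (ev_sub (N := R₁ + R₂) (fun b hb => hR₁ b (by omega))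
      (fun b hb => hR₂ b (by omega)) t).trans ?_
    have hgf := hg.ev_bracket hf hN (t - s) t y
    rw [ev_ev_apply hN (fun j => hg.cbr hf j), ev_eq_sum (N := N) fun j hj => by
      rw [hN j hj]; exact ev_zero t] at hgf
    have hSs : CE.ev t (CE.ev s S y)
        = -∑ j ∈ Finset.range N, (t - s) ^ j • CE.ev t (CE.cbr g f j y) := by
      rw [ev_ev_apply hS0 hS, ev_eq_sum (N := N) fun j hj => by
        rw [hS0 j hj]; exact ev_zero t]
      simp only [hSev, Finset.smul_sum]
      rw [Finset.sum_comm, ← Finset.sum_neg_distrib]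
      refine Finset.sum_congr rfl fun j hj => ?_
      simp only [smul_smul]
      rw [← Finset.sum_smul, ← neg_smul]
      congr 1
      rw [show t - s = -(s + -t) by ring, neg_pow (s + -t), add_pow, Finset.mul_sum,
        ← Finset.sum_neg_distrib]
      refine (Finset.sum_subset (Finset.range_mono (Finset.mem_range.1 hj)) fun i _ hi => ?_).symm.trans
        (Finset.sum_congr rfl fun i _ => ?_)
      · rw [Nat.choose_eq_zero_of_lt (by simpa using hi)]
        simp
      · ring
    rw [hf.ev_bracket hg hN', hSs, hgf, show t - (t - s) = s by ring]
    abel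
  rw [sub_eq_zero.1 (h a)]
  simp only [S, Finset.sum_apply, Pi.smul_apply, Int.cast_smul_eq_zsmul]

end Bracket

section TwoTerm

variable {A0 A1 : Type*} [AddCommGroup A0] [Module ℂ A0] [AddCommGroup A1] [Module ℂ A1]
  {D0 : A0 →ₗ[ℂ] A0} {D1 : A1 →ₗ[ℂ] A1} {dd : A1 →ₗ[ℂ] A0}

/-- A pair of families on `A0` and `A1`, as a family on `A0 × A1`. -/
def diagFam {A0 A1 : Type*} (F : (A0 → ℕ → A0) × (A1 → ℕ → A1)) : A0 × A1 → ℕ → A0 × A1 :=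
  fun z n => (F.1 z.1 n, F.2 z.2 n)

/-- A family from `A0` to `A1`, as a family on `A0 × A1`. -/
def offFam {A0 A1 : Type*} [Zero A0] (h : A0 → ℕ → A1) : A0 × A1 → ℕ → A0 × A1 :=
  fun z n => (0, h z.1 n)

theorem isCH_diagFam {F : (A0 → ℕ → A0) × (A1 → ℕ → A1)} (h0 : IsCH D0 D0 F.1)
    (h1 : IsCH D1 D1 F.2) : IsCH (D0.prodMap D1) (D0.prodMap D1) (diagFam F) := by
  refine ⟨fun x y n => ?_, fun c x n => ?_, fun x n => ?_, fun x => ?_⟩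
  · simp [diagFam, h0.1, h1.1]
  · simp [diagFam, h0.2.1, h1.2.1]
  · simp only [diagFam, LinearMap.prodMap_apply, h0.2.2.1, h1.2.2.1]
    split_ifs <;> simp
  · obtain ⟨N, hN⟩ := h0.2.2.2 x.1
    obtain ⟨N', hN'⟩ := h1.2.2.2 x.2
    refine ⟨N + N', fun n hn => ?_⟩
    rw [diagFam, hN n (by omega), hN' n (by omega)]
    rfl

theorem isCH_offFam_iff {h : A0 → ℕ → A1} :
    IsCH (D0.prodMap D1) (D0.prodMap D1) (offFam h) ↔ IsCH D0 D1 h := by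
  refine ⟨fun H => ⟨fun x y n => ?_, fun c x n => ?_, fun x n => ?_, fun x => ?_⟩,
    fun H => ⟨fun x y n => ?_, fun c x n => ?_, fun x n => ?_, fun x => ?_⟩⟩
  · exact congrArg Prod.snd (H.1 (x, 0) (y, 0) n)
  · exact congrArg Prod.snd (H.2.1 c (x, 0) n)
  · refine (congrArg Prod.snd (H.2.2.1 (x, 0) n)).trans ?_
    split_ifs <;> simp [offFam]
  · obtain ⟨N, hN⟩ := H.2.2.2 (x, 0)
    exact ⟨N, fun n hn => congrArg Prod.snd (hN n hn)⟩
  · simp [offFam, H.1]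
  · simp [offFam, H.2.1]
  · simp only [offFam, LinearMap.prodMap_apply, H.2.2.1]
    split_ifs <;> simp
  · obtain ⟨N, hN⟩ := H.2.2.2 x.1
    refine ⟨N, fun n hn => ?_⟩
    rw [offFam, hN n hn]
    rfl

theorem finPart_prodMap (h0 : FinPart D0) (h1 : FinPart D1) : FinPart (D0.prodMap D1) := by
  obtain ⟨n, y, hy⟩ := h0
  obtain ⟨m, z, hz⟩ := h1
  have hpow : ∀ i (x : A0 × A1), ((D0.prodMap D1) ^ i) x = ((D0 ^ i) x.1, (D1 ^ i) x.2) := by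
    intro i x
    induction i with
    | zero => simp
    | succ i ih => simp [pow_succ', ih]
  refine ⟨n + m, Fin.append (fun i => (y i, 0)) fun i => (0, z i), fun v => ?_⟩
  rw [show v = LinearMap.inl ℂ A0 A1 v.1 + LinearMap.inr ℂ A0 A1 v.2 by simp]
  refine Submodule.add_mem _ ?_ ?_
  · refine (Submodule.span_le (p := (Submodule.span ℂ _).comap (LinearMap.inl ℂ A0 A1))).2 ?_
      (hy v.1)
    rintro _ ⟨⟨i, k⟩, rfl⟩
    exact Submodule.subset_span ⟨(Fin.castAdd m i, k), by simp [hpow]⟩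
  · refine (Submodule.span_le (p := (Submodule.span ℂ _).comap (LinearMap.inr ℂ A0 A1))).2 ?_
      (hz v.2)
    rintro _ ⟨⟨i, k⟩, rfl⟩
    exact Submodule.subset_span ⟨(Fin.natAdd n i, k), by simp [hpow]⟩

theorem cbr_diagFam_diagFam {A0 A1 : Type*} [AddCommGroup A0] [AddCommGroup A1]
    (F G : (A0 → ℕ → A0) × (A1 → ℕ → A1)) (a : ℕ) :
    cbr (diagFam F) (diagFam G) a = diagFam (cbr F.1 G.1 a, cbr F.2 G.2 a) := by
  funext z b
  ext <;> simp [cbr, diagFam, Prod.fst_sum, Prod.snd_sum]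

theorem cbr_diagFam_offFam {A0 A1 : Type*} [AddCommGroup A0] [AddCommGroup A1]
    (f0 : A0 → ℕ → A0) (f1 : A1 → ℕ → A1) (h : A0 → ℕ → A1) (hf : ∀ n, f0 0 n = 0) (a : ℕ) :
    cbr (diagFam (f0, f1)) (offFam h) a = offFam (cbr01 f0 f1 h a) := by
  funext z b
  ext <;> simp [cbr, cbr01, diagFam, offFam, Prod.fst_sum, Prod.snd_sum, hf]

theorem cbr_offFam_diagFam {A0 A1 : Type*} [AddCommGroup A0] [AddCommGroup A1]
    (f0 : A0 → ℕ → A0) (f1 : A1 → ℕ → A1) (h : A0 → ℕ → A1) (hf : ∀ n, f0 0 n = 0) (a : ℕ) :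
    cbr (offFam h) (diagFam (f0, f1)) a = offFam (cbr10 h f0 f1 a) := by
  funext z b
  ext <;> simp [cbr, cbr10, diagFam, offFam, Prod.fst_sum, Prod.snd_sum, hf]

theorem Dch_offFam {A0 A1 : Type*} [AddCommGroup A0] [AddCommGroup A1] (h : A0 → ℕ → A1) :
    Dch (offFam h) = offFam (Dch h) := by
  funext z n
  cases n <;> ext <;> simp [Dch, offFam]

theorem Dch_diagFam {A0 A1 : Type*} [AddCommGroup A0] [AddCommGroup A1]
    (f0 : A0 → ℕ → A0) (f1 : A1 → ℕ → A1) :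
    Dch (diagFam (f0, f1)) = diagFam (Dch f0, Dch f1) := by
  funext z n
  cases n <;> ext <;> simp [Dch, diagFam]

theorem Dch_iterate_offFam {A0 A1 : Type*} [AddCommGroup A0] [AddCommGroup A1]
    (h : A0 → ℕ → A1) (i : ℕ) :
    (fun u : A0 × A1 → ℕ → A0 × A1 => Dch u)^[i] (offFam h)
      = offFam ((fun u : A0 → ℕ → A1 => Dch u)^[i] h) := by
  induction i with
  | zero => rfl
  | succ i ih => rw [Function.iterate_succ_apply', ih, Dch_offFam, Function.iterate_succ_apply']

theorem snd_substSum {A0 A1 : Type*} [AddCommMonoid A0] [AddCommMonoid A1]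
    (F : ℕ → ℕ → A0 × A1) (m n : ℕ) :
    (substSum F m n).2 = substSum (fun j s => (F j s).2) m n := by
  simp [substSum, Prod.snd_sum]

theorem IsC0.cbr {F G : (A0 → ℕ → A0) × (A1 → ℕ → A1)} (hF : IsC0 D0 D1 dd F)
    (hG : IsC0 D0 D1 dd G) (a : ℕ) : IsC0 D0 D1 dd (cbr F.1 G.1 a, cbr F.2 G.2 a) := by
  refine ⟨hF.1.cbr hG.1 a, hF.2.1.cbr hG.2.1 a, fun v n => ?_⟩
  simp only [CE.cbr, map_sum, map_zsmul, _root_.map_sub, hF.2.2, hG.2.2]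

theorem IsC0.isCH {F : (A0 → ℕ → A0) × (A1 → ℕ → A1)} (hF : IsC0 D0 D1 dd F) :
    IsCH (D0.prodMap D1) (D0.prodMap D1) (diagFam F) := isCH_diagFam hF.1 hF.2.1

theorem IsC0.isC1_cbr01 {F : (A0 → ℕ → A0) × (A1 → ℕ → A1)} {h : A0 → ℕ → A1}
    (hF : IsC0 D0 D1 dd F) (hh : IsC1 D0 D1 h) (a : ℕ) : IsC1 D0 D1 (cbr01 F.1 F.2 h a) := by
  rw [IsC1, ← isCH_offFam_iff, ← cbr_diagFam_offFam _ _ _ hF.1.map_zero]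
  exact hF.isCH.cbr (isCH_offFam_iff.2 hh) a

theorem IsC0.isC1_cbr10 {F : (A0 → ℕ → A0) × (A1 → ℕ → A1)} {h : A0 → ℕ → A1}
    (hF : IsC0 D0 D1 dd F) (hh : IsC1 D0 D1 h) (a : ℕ) : IsC1 D0 D1 (cbr10 h F.1 F.2 a) := by
  rw [IsC1, ← isCH_offFam_iff, ← cbr_offFam_diagFam _ _ _ hF.1.map_zero]
  exact IsCH.cbr (isCH_offFam_iff.2 hh) hF.isCH a

theorem IsC0.cbr01_Dch {F : (A0 → ℕ → A0) × (A1 → ℕ → A1)} {h : A0 → ℕ → A1}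
    (hF : IsC0 D0 D1 dd F) (hh : IsC1 D0 D1 h) (a : ℕ) (x : A0) (b : ℕ) :
    cbr01 (Dch F.1) (Dch F.2) h a x b
        = - (if a = 0 then 0 else cbr01 F.1 F.2 h (a - 1) x b) ∧
      cbr01 F.1 F.2 (Dch h) a x b
        = Dch (cbr01 F.1 F.2 h a) x b + (if a = 0 then 0 else cbr01 F.1 F.2 h (a - 1) x b) := by
  have hh' := isCH_offFam_iff.2 hh
  have e1 := hh'.cbr_Dch_left (diagFam F) a (x, 0) b
  have e2 := hF.isCH.cbr_Dch_right hh' a (x, 0) b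
  rw [Dch_diagFam, cbr_diagFam_offFam _ _ _ hF.1.Dch.map_zero,
    cbr_diagFam_offFam _ _ _ hF.1.map_zero] at e1
  rw [Dch_offFam, cbr_diagFam_offFam _ _ _ hF.1.map_zero, cbr_diagFam_offFam _ _ _ hF.1.map_zero,
    cbr_diagFam_offFam _ _ _ hF.1.map_zero, Dch_offFam] at e2
  refine ⟨(congrArg Prod.snd e1).trans ?_, (congrArg Prod.snd e2).trans ?_⟩ <;>
    split_ifs <;> simp [offFam]

theorem IsC0.cbr10_Dch {F : (A0 → ℕ → A0) × (A1 → ℕ → A1)} {h : A0 → ℕ → A1}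
    (hF : IsC0 D0 D1 dd F) (hh : IsC1 D0 D1 h) (a : ℕ) (x : A0) (b : ℕ) :
    cbr10 (Dch h) F.1 F.2 a x b
        = - (if a = 0 then 0 else cbr10 h F.1 F.2 (a - 1) x b) ∧
      cbr10 h (Dch F.1) (Dch F.2) a x b
        = Dch (cbr10 h F.1 F.2 a) x b + (if a = 0 then 0 else cbr10 h F.1 F.2 (a - 1) x b) := by
  have hh' := isCH_offFam_iff.2 hh
  have e1 := hF.isCH.cbr_Dch_left (offFam h) a (x, 0) b
  have e2 := hh'.cbr_Dch_right hF.isCH a (x, 0) b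
  rw [Dch_offFam, cbr_offFam_diagFam _ _ _ hF.1.map_zero,
    cbr_offFam_diagFam _ _ _ hF.1.map_zero] at e1
  rw [Dch_diagFam, cbr_offFam_diagFam _ _ _ hF.1.Dch.map_zero,
    cbr_offFam_diagFam _ _ _ hF.1.map_zero, cbr_offFam_diagFam _ _ _ hF.1.map_zero,
    Dch_offFam] at e2
  refine ⟨(congrArg Prod.snd e1).trans ?_, (congrArg Prod.snd e2).trans ?_⟩ <;>
    split_ifs <;> simp [offFam]

theorem IsC0.skew_offFam (hfin0 : FinPart D0) (hfin1 : FinPart D1)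
    {F : (A0 → ℕ → A0) × (A1 → ℕ → A1)} {h : A0 → ℕ → A1}
    (hF : IsC0 D0 D1 dd F) (hh : IsC1 D0 D1 h) : ∃ N,
      (∀ j, N ≤ j → ∀ x b, cbr10 h F.1 F.2 j x b = 0) ∧
      (∀ a x b, cbr01 F.1 F.2 h a x b
        = ∑ j ∈ Finset.range N, (((-1 : ℤ) ^ (j + 1)) * (j.choose a)) •
            (((fun u : A0 → ℕ → A1 => Dch u)^[j - a]) (cbr10 h F.1 F.2 j)) x b) := by
  have hh' := isCH_offFam_iff.2 hh
  have hD := finPart_prodMap hfin0 hfin1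
  obtain ⟨N, hN⟩ := hh'.exists_uniform_bound hD hF.isCH
  refine ⟨N, fun j hj x b => ?_, fun a x b => ?_⟩
  · have := hN j hj
    rw [cbr_offFam_diagFam _ _ _ hF.1.map_zero] at this
    exact congrArg Prod.snd (congrFun (congrFun this (x, 0)) b)
  · have := congrArg Prod.snd (hF.isCH.skew hD hh' hN a (x, 0) b)
    simp only [cbr_offFam_diagFam _ _ _ hF.1.map_zero, cbr_diagFam_offFam _ _ _ hF.1.map_zero,
      Dch_iterate_offFam, Prod.snd_sum] at this
    exact this

end TwoTerm

/-- For a `2`-term complex `A₁ →d A₀` of finite `ℂ[∂]`-modules,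
`CEnd(A) = CEnd⁰(A) ⊕ CEnd¹(A)` with the differential `Δ(h) = (d∘h, h∘d)` and the
`λ`-brackets `[(f₀,f₁)_λ (g₀,g₁)] = ((f₀)_λ g₀ − (g₀)_{−∂−λ} f₀, (f₁)_λ g₁ − (g₁)_{−∂−λ} f₁)`
and `[(f₀,f₁)_λ h] = −[h_{−∂−λ} (f₀,f₁)] = (f₁)_λ h − h_{−∂−λ} f₀` is a differential
graded Lie conformal algebra: the bracket is closed, conformal sesquilinear, graded
skew-symmetric, satisfies the graded Jacobi identity, `Δ² = 0`, `Δ` is `ℂ[∂]`-linear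
and is a graded derivation of the bracket. -/
theorem stmt18 {A0 A1 : Type*} [AddCommGroup A0] [Module ℂ A0] [AddCommGroup A1] [Module ℂ A1]
    (D0 : A0 →ₗ[ℂ] A0) (D1 : A1 →ₗ[ℂ] A1)
    (hfin0 : FinPart D0) (hfin1 : FinPart D1)
    (dd : A1 →ₗ[ℂ] A0) (hddD : ∀ v, dd (D1 v) = D0 (dd v)) :
    -- (closure) the brackets and `Δ` take values in `CEnd⁰(A)` resp. `CEnd¹(A)`
    (∀ F G, IsC0 D0 D1 dd F → IsC0 D0 D1 dd G → ∀ a,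
      IsC0 D0 D1 dd (cbr F.1 G.1 a, cbr F.2 G.2 a)) ∧
    (∀ F h, IsC0 D0 D1 dd F → IsC1 D0 D1 h → ∀ a, IsC1 D0 D1 (cbr01 F.1 F.2 h a)) ∧
    (∀ h F, IsC1 D0 D1 h → IsC0 D0 D1 dd F → ∀ a, IsC1 D0 D1 (cbr10 h F.1 F.2 a)) ∧
    (∀ h, IsC1 D0 D1 h →
      IsC0 D0 D1 dd ((fun x n => dd (h x n)), (fun v n => h (dd v) n))) ∧
    -- (conformal sesquilinearity of the λ-bracket)
    (∀ F G, IsC0 D0 D1 dd F → IsC0 D0 D1 dd G → ∀ a,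
      (∀ x b, cbr (Dch F.1) G.1 a x b = - (if a = 0 then 0 else cbr F.1 G.1 (a - 1) x b)) ∧
      (∀ v c, cbr (Dch F.2) G.2 a v c = - (if a = 0 then 0 else cbr F.2 G.2 (a - 1) v c)) ∧
      (∀ x b, cbr F.1 (Dch G.1) a x b
        = Dch (cbr F.1 G.1 a) x b + (if a = 0 then 0 else cbr F.1 G.1 (a - 1) x b)) ∧
      (∀ v c, cbr F.2 (Dch G.2) a v c
        = Dch (cbr F.2 G.2 a) v c + (if a = 0 then 0 else cbr F.2 G.2 (a - 1) v c))) ∧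
    (∀ F h, IsC0 D0 D1 dd F → IsC1 D0 D1 h → ∀ a x b,
      cbr01 (Dch F.1) (Dch F.2) h a x b
        = - (if a = 0 then 0 else cbr01 F.1 F.2 h (a - 1) x b) ∧
      cbr01 F.1 F.2 (Dch h) a x b
        = Dch (cbr01 F.1 F.2 h a) x b + (if a = 0 then 0 else cbr01 F.1 F.2 h (a - 1) x b)) ∧
    (∀ h F, IsC1 D0 D1 h → IsC0 D0 D1 dd F → ∀ a x b,
      cbr10 (Dch h) F.1 F.2 a x b
        = - (if a = 0 then 0 else cbr10 h F.1 F.2 (a - 1) x b) ∧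
      cbr10 h (Dch F.1) (Dch F.2) a x b
        = Dch (cbr10 h F.1 F.2 a) x b + (if a = 0 then 0 else cbr10 h F.1 F.2 (a - 1) x b)) ∧
    -- (graded skew-symmetry: `[a_λ b] = −(−1)^{|a||b|}[b_{−∂−λ} a]`)
    (∀ F G, IsC0 D0 D1 dd F → IsC0 D0 D1 dd G → ∃ N,
      (∀ j, N ≤ j → (∀ x b, cbr G.1 F.1 j x b = 0) ∧ (∀ v c, cbr G.2 F.2 j v c = 0)) ∧
      (∀ a x b, cbr F.1 G.1 a x b
        = ∑ j ∈ Finset.range N, (((-1 : ℤ) ^ (j + 1)) * (j.choose a)) •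
            (((fun u : A0 → ℕ → A0 => Dch u)^[j - a]) (cbr G.1 F.1 j)) x b) ∧
      (∀ a v c, cbr F.2 G.2 a v c
        = ∑ j ∈ Finset.range N, (((-1 : ℤ) ^ (j + 1)) * (j.choose a)) •
            (((fun u : A1 → ℕ → A1 => Dch u)^[j - a]) (cbr G.2 F.2 j)) v c)) ∧
    (∀ F h, IsC0 D0 D1 dd F → IsC1 D0 D1 h → ∃ N,
      (∀ j, N ≤ j → ∀ x b, cbr10 h F.1 F.2 j x b = 0) ∧
      (∀ a x b, cbr01 F.1 F.2 h a x b
        = ∑ j ∈ Finset.range N, (((-1 : ℤ) ^ (j + 1)) * (j.choose a)) •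
            (((fun u : A0 → ℕ → A1 => Dch u)^[j - a]) (cbr10 h F.1 F.2 j)) x b)) ∧
    -- (graded Jacobi identity, in all degree combinations)
    (∀ F G K, IsC0 D0 D1 dd F → IsC0 D0 D1 dd G → IsC0 D0 D1 dd K → ∀ m n,
      (∀ x b, cbr F.1 (cbr G.1 K.1 n) m x b
        = substSum (fun j s => cbr (cbr F.1 G.1 j) K.1 s x b) m n
          + cbr G.1 (cbr F.1 K.1 m) n x b) ∧
      (∀ v c, cbr F.2 (cbr G.2 K.2 n) m v c
        = substSum (fun j s => cbr (cbr F.2 G.2 j) K.2 s v c) m n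
          + cbr G.2 (cbr F.2 K.2 m) n v c)) ∧
    (∀ F G h, IsC0 D0 D1 dd F → IsC0 D0 D1 dd G → IsC1 D0 D1 h → ∀ m n x b,
      cbr01 F.1 F.2 (cbr01 G.1 G.2 h n) m x b
        = substSum (fun j s => cbr01 (cbr F.1 G.1 j) (cbr F.2 G.2 j) h s x b) m n
          + cbr01 G.1 G.2 (cbr01 F.1 F.2 h m) n x b) ∧
    (∀ F h G, IsC0 D0 D1 dd F → IsC1 D0 D1 h → IsC0 D0 D1 dd G → ∀ m n x b,
      cbr01 F.1 F.2 (cbr10 h G.1 G.2 n) m x b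
        = substSum (fun j s => cbr10 (cbr01 F.1 F.2 h j) G.1 G.2 s x b) m n
          + cbr10 h (cbr F.1 G.1 m) (cbr F.2 G.2 m) n x b) ∧
    (∀ h F G, IsC1 D0 D1 h → IsC0 D0 D1 dd F → IsC0 D0 D1 dd G → ∀ m n x b,
      cbr10 h (cbr F.1 G.1 n) (cbr F.2 G.2 n) m x b
        = substSum (fun j s => cbr10 (cbr10 h F.1 F.2 j) G.1 G.2 s x b) m n
          + cbr01 F.1 F.2 (cbr10 h G.1 G.2 m) n x b) ∧
    -- (`Δ² = 0`)
    (∀ u, DGdiff dd (DGdiff dd u) = (((fun _ _ => 0), (fun _ _ => 0)), fun _ _ => 0)) ∧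
    -- (`Δ` is `ℂ[∂]`-linear)
    (∀ h : A0 → ℕ → A1,
      (fun x n => dd (Dch h x n)) = Dch (fun y m => dd (h y m)) ∧
      (fun v n => Dch h (dd v) n) = Dch (fun w m => h (dd w) m)) ∧
    -- (`Δ` is a graded derivation of the λ-bracket)
    (∀ F h, IsC0 D0 D1 dd F → IsC1 D0 D1 h → ∀ a,
      (∀ x b, dd (cbr01 F.1 F.2 h a x b) = cbr F.1 (fun y m => dd (h y m)) a x b) ∧
      (∀ v b, cbr01 F.1 F.2 h a (dd v) b = cbr F.2 (fun w m => h (dd w) m) a v b)) ∧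
    (∀ h F, IsC1 D0 D1 h → IsC0 D0 D1 dd F → ∀ a,
      (∀ x b, dd (cbr10 h F.1 F.2 a x b) = cbr (fun y m => dd (h y m)) F.1 a x b) ∧
      (∀ v b, cbr10 h F.1 F.2 a (dd v) b = cbr (fun w m => h (dd w) m) F.2 a v b)) := by
  have hD := finPart_prodMap hfin0 hfin1
  refine ⟨fun F G hF hG a => hF.cbr hG a, fun F h hF hh a => hF.isC1_cbr01 hh a,
    fun h F hh hF a => hF.isC1_cbr10 hh a, fun h hh => ?_, fun F G hF hG a => ?_,
    fun F h hF hh a x b => hF.cbr01_Dch hh a x b, fun h F hh hF a x b => hF.cbr10_Dch hh a x b,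
    fun F G hF hG => ?_, fun F h hF hh => hF.skew_offFam hfin0 hfin1 hh,
    fun F G K hF hG hK m n => ⟨hF.1.jacobi hfin0 hG.1 hK.1 m n,
      hF.2.1.jacobi hfin1 hG.2.1 hK.2.1 m n⟩,
    fun F G h hF hG hh m n x b => ?_, fun F h G hF hh hG m n x b => ?_,
    fun h F G hh hF hG m n x b => ?_, fun u => ?_, fun h => ⟨?_, ?_⟩, fun F h hF hh a => ?_,
    fun h F hh hF a => ?_⟩
  · refine ⟨⟨fun x y n => ?_, fun c x n => ?_, fun x n => ?_, fun x => ?_⟩,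
      ⟨fun x y n => ?_, fun c x n => ?_, fun x n => ?_, fun x => hh.2.2.2 _⟩, fun v n => rfl⟩
    · simp only [hh.1, map_add]
    · simp only [hh.2.1, map_smul]
    · simp only [hh.2.2.1, map_add, hddD]
      split_ifs <;> simp
    · obtain ⟨N, hN⟩ := hh.2.2.2 x
      exact ⟨N, fun n hn => by simp only [hN n hn, map_zero]⟩
    · simp only [map_add, hh.1]
    · simp only [map_smul, hh.2.1]
    · simp only [hddD, hh.2.2.1]
  · exact ⟨hG.1.cbr_Dch_left F.1 a, hG.2.1.cbr_Dch_left F.2 a, hF.1.cbr_Dch_right hG.1 a,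
      hF.2.1.cbr_Dch_right hG.2.1 a⟩
  · obtain ⟨N, hN⟩ := hG.1.exists_uniform_bound hfin0 hF.1
    obtain ⟨N', hN'⟩ := hG.2.1.exists_uniform_bound hfin1 hF.2.1
    have h0 : ∀ j, max N N' ≤ j → cbr G.1 F.1 j = 0 := fun j hj =>
      hN j (le_trans (le_max_left _ _) hj)
    have h1 : ∀ j, max N N' ≤ j → cbr G.2 F.2 j = 0 := fun j hj =>
      hN' j (le_trans (le_max_right _ _) hj)
    exact ⟨max N N', fun j hj => ⟨fun x b => congrFun (congrFun (h0 j hj) x) b,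
      fun v c => congrFun (congrFun (h1 j hj) v) c⟩, hF.1.skew hfin0 hG.1 h0,
      hF.2.1.skew hfin1 hG.2.1 h1⟩
  · have := congrArg Prod.snd
      (hF.isCH.jacobi hD hG.isCH (isCH_offFam_iff.2 hh) m n (x, 0) b)
    simp only [cbr_diagFam_diagFam, cbr_diagFam_offFam _ _ _ hF.1.map_zero,
      cbr_diagFam_offFam _ _ _ hG.1.map_zero,
      fun j => cbr_diagFam_offFam _ (cbr F.2 G.2 j) h (hF.1.cbr hG.1 j).map_zero,
      Prod.snd_add, snd_substSum] at this
    exact this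
  · have := congrArg Prod.snd
      (hF.isCH.jacobi hD (isCH_offFam_iff.2 hh) hG.isCH m n (x, 0) b)
    simp only [cbr_diagFam_diagFam, cbr_diagFam_offFam _ _ _ hF.1.map_zero,
      cbr_offFam_diagFam _ _ _ hG.1.map_zero,
      fun j => cbr_offFam_diagFam _ (cbr F.2 G.2 j) h (hF.1.cbr hG.1 j).map_zero,
      Prod.snd_add, snd_substSum] at this
    exact this
  · have := congrArg Prod.snd
      (IsCH.jacobi hD (isCH_offFam_iff.2 hh) hF.isCH hG.isCH m n (x, 0) b)
    simp only [cbr_diagFam_diagFam, cbr_offFam_diagFam _ _ _ hF.1.map_zero,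
      cbr_offFam_diagFam _ _ _ hG.1.map_zero, cbr_diagFam_offFam _ _ _ hF.1.map_zero,
      fun j => cbr_offFam_diagFam _ (cbr F.2 G.2 j) h (hF.1.cbr hG.1 j).map_zero,
      Prod.snd_add, snd_substSum] at this
    exact this
  · simp [DGdiff]
  · funext x n
    cases n <;> simp [Dch]
  · funext x n
    cases n <;> rfl
  · exact ⟨fun x b => by simp only [cbr01, cbr, map_sum, map_zsmul, map_sub, hF.2.2],
      fun v b => by simp only [cbr01, cbr, hF.2.2]⟩
  · exact ⟨fun x b => by simp only [cbr10, cbr, map_sum, map_zsmul, map_sub, hF.2.2],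
      fun v b => by simp only [cbr10, cbr, hF.2.2]⟩
end CE
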